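/- Let S be a finite meet-semilattice with least element 0 and greatest element 1 of order n ≥ 6. Then for every subset Y ⊆ S, the number of one-variable equations over S (of either kind) whose solution set equals Y is at most the number of one-variable equations over S whose solution set is empty. -/

import Mathlib

/-- The solution set of the first-kind one-variable equation `x ⊓ a = x ⊓ a′`
given by the ordered pair `p = (a, a′)`. -/
def solSet₁ {S : Type*} [SemilatticeInf S] (p : S × S) : Set S :=
  {s : S | s ⊓ p.1 = s ⊓ p.2}

/-- The solution set of the second-kind one-variable equation `x ⊓ a = b`
given by the ordered pair `p = (a, b)`. -/
def solSet₂ {S : Type*} [SemilatticeInf S] (p : S × S) : Set S :=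
  {s : S | s ⊓ p.1 = p.2}

/-- The number of one-variable equations over `S` (of both kinds, counted as
distinct objects) whose solution set equals `Y`. -/
noncomputable def numEqWithSolSet (S : Type*) [SemilatticeInf S] (Y : Set S) : ℕ :=
  Nat.card {p : S × S // solSet₁ p = Y} + Nat.card {p : S × S // solSet₂ p = Y}

section EquationCounting

open Finset

open Classical in
theorem card_ne_pairs (α : Type*) [Fintype α] :
    #{p : α × α | ¬ p.1 = p.2} + Fintype.card α = Fintype.card α * Fintype.card α := by
  have h : ({p : α × α | ¬ p.1 = p.2} : Finset (α × α)) = (univ : Finset α).offDiag := by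
    ext p
    simp
  rw [h, offDiag_card, card_univ]
  exact Nat.sub_add_cancel (Nat.le_mul_self _)

variable {S : Type*} [SemilatticeInf S]

theorem mem_solSet₁ {a b x : S} : x ∈ solSet₁ (a, b) ↔ x ⊓ a = x ⊓ b := Iff.rfl

theorem mem_solSet₂ {a b x : S} : x ∈ solSet₂ (a, b) ↔ x ⊓ a = b := Iff.rfl

theorem solSet₁_swap (a b : S) : solSet₁ (b, a) = solSet₁ (a, b) :=
  Set.ext fun _ => eq_comm

theorem solSet₁_eq_univ_iff {a b : S} : solSet₁ (a, b) = Set.univ ↔ a = b := by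
  refine ⟨fun h => ?_, fun h => by subst h; exact Set.eq_univ_of_forall fun _ => rfl⟩
  have ha : a ⊓ a = a ⊓ b := mem_solSet₁.1 (h ▸ Set.mem_univ a)
  have hb : b ⊓ a = b ⊓ b := mem_solSet₁.1 (h ▸ Set.mem_univ b)
  rw [inf_idem] at ha hb
  exact le_antisymm (inf_eq_left.1 ha.symm) (inf_eq_left.1 hb)

theorem solSet₂_eq_empty_iff {a b : S} : solSet₂ (a, b) = ∅ ↔ ¬ b ≤ a := by
  rw [Set.eq_empty_iff_forall_notMem]
  refine ⟨fun h hba => h b (inf_eq_left.2 hba), fun h x hx => h ?_⟩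
  rw [← mem_solSet₂.1 hx]
  exact inf_le_right

/-- The right-hand side of a consistent second-kind equation is its least solution. -/
theorem isLeast_solSet₂ {a b : S} (h : (solSet₂ (a, b)).Nonempty) :
    IsLeast (solSet₂ (a, b)) b := by
  obtain ⟨x, hx⟩ := h
  have hba : b ≤ a := by rw [← mem_solSet₂.1 hx]; exact inf_le_right
  refine ⟨inf_eq_left.2 hba, fun y hy => ?_⟩
  rw [← mem_solSet₂.1 hy]
  exact inf_le_left

theorem le_of_solSet₁_eq {a b c : S} (hac : a ≤ c) (h : solSet₁ (a, c) = solSet₁ (b, c)) :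
    a ≤ b := by
  have ha : a ∈ solSet₁ (b, c) := h ▸ mem_solSet₁.2 (by rw [inf_idem, inf_eq_left.2 hac])
  rw [mem_solSet₁, inf_eq_left.2 hac] at ha
  exact inf_eq_left.1 ha

/-- An element that is the upper end of a comparable pair with solution set `Y` lies in no
incomparable pair with solution set `Y`. -/
theorem le_of_solSet₁_eq_of_le {a b c : S} (hac : a ≤ c)
    (h : solSet₁ (a, c) = solSet₁ (c, b)) : b ≤ c := by
  have hab : a ≤ b := by
    have ha : a ∈ solSet₁ (c, b) := h ▸ mem_solSet₁.2 (by rw [inf_idem, inf_eq_left.2 hac])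
    rw [mem_solSet₁, inf_eq_left.2 hac] at ha
    exact inf_eq_left.1 ha.symm
  have hm : b ⊓ c ∈ solSet₁ (a, c) := by
    rw [h, mem_solSet₁, inf_eq_left.2 inf_le_right, inf_eq_left.2 inf_le_left]
  rw [mem_solSet₁, inf_eq_left.2 inf_le_right, inf_eq_left] at hm
  have hb : b ∈ solSet₁ (c, b) := by
    rw [← h, mem_solSet₁, inf_eq_right.2 hab]
    exact le_antisymm (le_inf hab hac) hm
  rw [mem_solSet₁, inf_idem] at hb
  exact inf_eq_left.1 hb

theorem fst_injOn_solSet₂ {Y : Set S} (hY : Y.Nonempty) :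
    Set.InjOn Prod.fst {p : S × S | solSet₂ p = Y} := by
  rintro ⟨a, b⟩ h ⟨a', b'⟩ h' (rfl : a = a')
  have h : solSet₂ (a, b) = Y := h
  have h' : solSet₂ (a, b') = Y := h'
  have hb : IsLeast Y b := h ▸ isLeast_solSet₂ (h ▸ hY)
  have hb' : IsLeast Y b' := h' ▸ isLeast_solSet₂ (h' ▸ hY)
  rw [hb.unique hb']

variable [Fintype S]

open Classical in
theorem card_offDiag_add_card_incomparable :
    #{p : S × S | ¬ p.1 = p.2} + #{p : S × S | ¬ p.1 ≤ p.2 ∧ ¬ p.2 ≤ p.1} =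
      2 * #{p : S × S | ¬ p.2 ≤ p.1} := by
  have hswap : #{p : S × S | ¬ p.1 ≤ p.2} = #{p : S × S | ¬ p.2 ≤ p.1} :=
    card_equiv (Equiv.prodComm S S) (by simp)
  have hunion : ({p : S × S | ¬ p.1 = p.2} : Finset (S × S)) =
      (univ.filter fun p => ¬ p.1 ≤ p.2) ∪ univ.filter fun p => ¬ p.2 ≤ p.1 := by
    ext p
    simp only [mem_filter, mem_univ, true_and, mem_union, le_antisymm_iff]
    tauto
  have hinter : ({p : S × S | ¬ p.1 ≤ p.2 ∧ ¬ p.2 ≤ p.1} : Finset (S × S)) =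
      (univ.filter fun p => ¬ p.1 ≤ p.2) ∩ univ.filter fun p => ¬ p.2 ≤ p.1 := by
    ext p
    simp
  rw [hunion, hinter, card_union_add_card_inter, hswap, two_mul]

open Classical in
theorem numEqWithSolSet_eq_card (Y : Set S) :
    numEqWithSolSet S Y = #{p : S × S | solSet₁ p = Y} + #{p : S × S | solSet₂ p = Y} := by
  simp only [numEqWithSolSet, Nat.card_eq_fintype_card, Fintype.card_subtype]

open Classical in
theorem numEqWithSolSet_empty [OrderBot S] :
    numEqWithSolSet S (∅ : Set S) = #{p : S × S | ¬ p.2 ≤ p.1} := by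
  have h₁ : #{p : S × S | solSet₁ p = ∅} = 0 := by
    rw [card_eq_zero, filter_eq_empty_iff]
    rintro ⟨a, b⟩ - h
    have : (⊥ : S) ∈ solSet₁ (a, b) := by simp [mem_solSet₁]
    simp [h] at this
  rw [numEqWithSolSet_eq_card, h₁, zero_add]
  congr 1
  ext ⟨a, b⟩
  simp [solSet₂_eq_empty_iff]

open Classical in
theorem card_solSet₂_eq_le {Y : Set S} (hY : Y.Nonempty) :
    #{p : S × S | solSet₂ p = Y} ≤ Fintype.card S :=
  card_le_card_of_injOn Prod.fst (fun _ _ => mem_univ _)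
    (by simpa using fst_injOn_solSet₂ hY)

open Classical in
/-- If `⊥ ∈ Y`, a second-kind equation with solution set `Y` has right-hand side `⊥`, so it
amounts to a first-kind equation whose left constant is `⊥`. -/
theorem card_solSet₂_eq_le_card_lt [OrderBot S] {Y : Set S} (hY : Y ≠ Set.univ)
    (hbot : ⊥ ∈ Y) :
    #{p : S × S | solSet₂ p = Y} ≤ #{p : S × S | solSet₁ p = Y ∧ p.1 < p.2} := by
  refine card_le_card_of_injOn (fun p => (⊥, p.1)) ?_ ?_
  · rintro ⟨a, b⟩ h
    simp only [coe_filter, mem_univ, true_and, Set.mem_ofPred_eq] at h ⊢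
    have hb : ⊥ ⊓ a = b := mem_solSet₂.1 (h ▸ hbot)
    rw [bot_inf_eq] at hb
    subst hb
    have h₁ : solSet₁ (⊥, a) = Y := by
      rw [← h]
      ext x
      rw [mem_solSet₁, mem_solSet₂, inf_bot_eq, eq_comm]
    refine ⟨h₁, bot_lt_iff_ne_bot.2 fun ha => hY ?_⟩
    rw [← h₁, solSet₁_eq_univ_iff, ha]
  · intro p hp q hq hpq
    exact fst_injOn_solSet₂ ⟨⊥, hbot⟩ (by simpa using hp) (by simpa using hq)
      (Prod.ext_iff.1 hpq).2

open Classical in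
theorem card_solSet₁_eq_of_ne_univ {Y : Set S} (hY : Y ≠ Set.univ) :
    #{p : S × S | solSet₁ p = Y} = 2 * #{p : S × S | solSet₁ p = Y ∧ p.1 < p.2} +
      #{p : S × S | solSet₁ p = Y ∧ ¬ p.1 ≤ p.2 ∧ ¬ p.2 ≤ p.1} := by
  have hswap : #{p : S × S | solSet₁ p = Y ∧ p.2 < p.1} =
      #{p : S × S | solSet₁ p = Y ∧ p.1 < p.2} :=
    card_equiv (Equiv.prodComm S S) fun ⟨a, b⟩ => by simp [solSet₁_swap]
  have hunion : ({p : S × S | solSet₁ p = Y} : Finset (S × S)) =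
      ((univ.filter fun p => solSet₁ p = Y ∧ p.1 < p.2) ∪
        univ.filter fun p => solSet₁ p = Y ∧ p.2 < p.1) ∪
          univ.filter fun p => solSet₁ p = Y ∧ ¬ p.1 ≤ p.2 ∧ ¬ p.2 ≤ p.1 := by
    ext ⟨a, b⟩
    simp only [mem_filter, mem_univ, true_and, mem_union, lt_iff_le_not_ge]
    have hne : solSet₁ (a, b) = Y → ¬ (a ≤ b ∧ b ≤ a) := fun h hab =>
      hY (by rw [← h, solSet₁_eq_univ_iff]; exact le_antisymm hab.1 hab.2)
    tauto
  rw [hunion, card_union_of_disjoint, card_union_of_disjoint, hswap, two_mul]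
  · exact disjoint_filter.2 fun p _ h h' => lt_asymm h.2 h'.2
  · rw [disjoint_union_left]
    exact ⟨disjoint_filter.2 fun p _ h h' => h'.2.1 h.2.le,
      disjoint_filter.2 fun p _ h h' => h'.2.2 h.2.le⟩

open Classical in
theorem six_mul_card_lt_add_card_incomparable_le [OrderBot S] (hn : 6 ≤ Fintype.card S)
    (Y : Set S) :
    6 * #{p : S × S | solSet₁ p = Y ∧ p.1 < p.2} +
      #{p : S × S | solSet₁ p = Y ∧ ¬ p.1 ≤ p.2 ∧ ¬ p.2 ≤ p.1} + Fintype.card S ≤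
      Fintype.card S * Fintype.card S := by
  set L : Finset (S × S) := {p | solSet₁ p = Y ∧ p.1 < p.2} with hL
  set P : Finset (S × S) := {p | solSet₁ p = Y ∧ ¬ p.1 ≤ p.2 ∧ ¬ p.2 ≤ p.1} with hP
  have hLcard : #(L.image Prod.snd) = #L := by
    refine card_image_of_injOn ?_
    rintro ⟨a, c⟩ h ⟨b, c'⟩ h' (rfl : c = c')
    simp only [hL, coe_filter, mem_univ, true_and, Set.mem_ofPred_eq] at h h'
    rw [le_antisymm (le_of_solSet₁_eq h.2.le (h.1.trans h'.1.symm))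
      (le_of_solSet₁_eq h'.2.le (h'.1.trans h.1.symm))]
  have hPsub : P ⊆ (P.image Prod.fst).offDiag := by
    rintro ⟨a, b⟩ h
    have h' : (b, a) ∈ P := by
      simp only [hP, mem_filter, mem_univ, true_and] at h ⊢
      exact ⟨(solSet₁_swap a b).trans h.1, h.2.2, h.2.1⟩
    refine mem_offDiag.2 ⟨mem_image_of_mem _ h, mem_image_of_mem Prod.fst h', ?_⟩
    rintro (rfl : a = b)
    exact (mem_filter.1 h).2.2.1 le_rfl
  have hPcard : #P + #(P.image Prod.fst) ≤ #(P.image Prod.fst) * #(P.image Prod.fst) := by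
    have h := card_le_card hPsub
    rw [offDiag_card] at h
    have := Nat.le_mul_self #(P.image Prod.fst)
    omega
  have hdisj : Disjoint (L.image Prod.snd) (P.image Prod.fst) := by
    rw [disjoint_left]
    intro c hc hc'
    obtain ⟨⟨a, c⟩, h, rfl⟩ := mem_image.1 hc
    obtain ⟨⟨c', b⟩, h', rfl : c' = c⟩ := mem_image.1 hc'
    have h := (mem_filter.1 h).2
    have h' := (mem_filter.1 h').2
    exact h'.2.2 (le_of_solSet₁_eq_of_le h.2.le (h.1.trans h'.1.symm))
  have hbot : ⊥ ∉ L.image Prod.snd ∪ P.image Prod.fst := by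
    rw [mem_union, mem_image, mem_image]
    rintro (⟨p, h, hp⟩ | ⟨p, h, hp⟩)
    · exact not_lt_bot (hp ▸ (mem_filter.1 h).2.2)
    · exact (mem_filter.1 h).2.2.1 (hp ▸ bot_le)
  have hlt : #L + #(P.image Prod.fst) < Fintype.card S := by
    rw [← hLcard, ← card_union_of_disjoint hdisj]
    exact card_lt_univ_of_notMem hbot
  generalize #(P.image Prod.fst) = d at *
  generalize #L = k at *
  generalize #P = m at *
  generalize Fintype.card S = n at *
  obtain ⟨j, rfl⟩ : ∃ j, n = k + d + 1 + j := ⟨n - (k + d + 1), by omega⟩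
  rcases Nat.eq_zero_or_pos d with rfl | hd
  · nlinarith
  · nlinarith

end EquationCounting

theorem stmt_4 (S : Type*) [Fintype S] [SemilatticeInf S] [OrderBot S] [OrderTop S]
    (hn : 6 ≤ Fintype.card S) (Y : Set S) :
    numEqWithSolSet S Y ≤ numEqWithSolSet S (∅ : Set S) := by
  classical
  rcases Y.eq_empty_or_nonempty with rfl | hne
  · exact le_rfl
  have hcount := card_offDiag_add_card_incomparable (S := S)
  have hoff := card_ne_pairs S
  have h₂ := card_solSet₂_eq_le hne
  have hsq : 6 * Fintype.card S ≤ Fintype.card S * Fintype.card S := Nat.mul_le_mul_right _ hn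
  rw [numEqWithSolSet_empty, numEqWithSolSet_eq_card]
  by_cases hY : Y = Set.univ
  · have h₁ : Finset.card {p : S × S | solSet₁ p = Y} ≤ Fintype.card S := by
      refine Finset.card_le_card_of_injOn Prod.fst (fun _ _ => Finset.mem_univ _) ?_
      rintro ⟨a, b⟩ h ⟨a', b'⟩ h' (rfl : a = a')
      simp only [Finset.coe_filter, Finset.mem_univ, true_and, Set.mem_ofPred_eq, hY,
        solSet₁_eq_univ_iff] at h h'
      rw [← h, ← h']
    omega
  by_cases hbot : ⊥ ∈ Y
  · have h₂' := card_solSet₂_eq_le_card_lt hY hbot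
    have h₁ := card_solSet₁_eq_of_ne_univ hY
    have hmain := six_mul_card_lt_add_card_incomparable_le hn Y
    have hinc : Finset.card {p : S × S | solSet₁ p = Y ∧ ¬ p.1 ≤ p.2 ∧ ¬ p.2 ≤ p.1} ≤
        Finset.card {p : S × S | ¬ p.1 ≤ p.2 ∧ ¬ p.2 ≤ p.1} :=
      Finset.card_le_card (Finset.monotone_filter_right _ fun _ _ h => h.2)
    omega
  · have h₁ : Finset.card {p : S × S | solSet₁ p = Y} = 0 := by
      rw [Finset.card_eq_zero, Finset.filter_eq_empty_iff]
      rintro ⟨a, b⟩ - rfl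
      exact hbot (by simp [mem_solSet₁])
    omega
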